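/- arXiv:1909.05612 — 2 statements merged into one kernel-verified Lean document; each statement's English description precedes it below -/
import Mathlib

section
/- Law of large numbers for the Curie–Weiss model, supercritical case: fix β > 1. For each N ≥ 1 let (X_1^{(N)},…,X_N^{(N)}) be CW(β,N)-distributed and S_N = ∑_{i=1}^N X_i^{(N)}. Then the laws of S_N/N converge weakly, as N → ∞, to the measure (1/2)(δ_{−m(β)} + δ_{m(β)}), where m(β) > 0 is the unique positive solution of x = tanh(βx). -/
open MeasureTheory Filter Real Topology ENNReal

/-- The spin value associated to a Boolean: `true ↦ +1`, `false ↦ -1`. -/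
noncomputable def spin (b : Bool) : ℝ := if b then 1 else -1

/-- The (unnormalized) Curie–Weiss Boltzmann weight of a configuration. -/
noncomputable def cwWeight (β : ℝ) (N : ℕ) (σ : Fin N → Bool) : ℝ :=
  Real.exp (β / (2 * N) * (∑ i, spin (σ i)) ^ 2)

/-- The Curie–Weiss partition function. -/
noncomputable def cwZ (β : ℝ) (N : ℕ) : ℝ :=
  ∑ σ : Fin N → Bool, cwWeight β N σ

/-- Expectation with respect to the Curie–Weiss distribution `CW(β,N)`. -/
noncomputable def cwExp (β : ℝ) (N : ℕ) (f : (Fin N → Bool) → ℝ) : ℝ :=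
  (∑ σ : Fin N → Bool, cwWeight β N σ * f σ) / cwZ β N

/-- Law on `ℝ` of the observable `g` under the Curie–Weiss distribution `CW(β,N)`. -/
noncomputable def cwLaw (β : ℝ) (N : ℕ) (g : (Fin N → Bool) → ℝ) : Measure ℝ :=
  ∑ σ : Fin N → Bool, ENNReal.ofReal (cwWeight β N σ / cwZ β N) • Measure.dirac (g σ)

/-- The correlation `E_{β,N}(X_1 ⋯ X_ℓ)` of the first `ℓ` spins. -/
noncomputable def cwCorr (β : ℝ) (N ℓ : ℕ) : ℝ :=
  cwExp β N (fun σ => ∏ j ∈ Finset.univ.filter (fun j : Fin N => (j : ℕ) < ℓ), spin (σ j))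

/-- The exponential of the mean-field free energy `log cosh (β x) - β x² / 2`. -/
noncomputable def cwProfile (β x : ℝ) : ℝ := Real.exp (-(β * x ^ 2 / 2)) * Real.cosh (β * x)

lemma cwProfile_pos (β x : ℝ) : 0 < cwProfile β x :=
  mul_pos (Real.exp_pos _) (Real.cosh_pos _)

lemma cwProfile_neg (β x : ℝ) : cwProfile β (-x) = cwProfile β x := by
  simp [cwProfile]

lemma cwProfile_abs (β x : ℝ) : cwProfile β |x| = cwProfile β x := by
  rcases abs_choice x with h | h <;> simp [h, cwProfile_neg]

lemma hasDerivAt_cwProfile (β x : ℝ) :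
    HasDerivAt (cwProfile β) (β * cwProfile β x * (Real.tanh (β * x) - x)) x := by
  have h1 : HasDerivAt (fun x : ℝ => -(β * x ^ 2 / 2)) (-(β * x)) x := by
    refine ((((hasDerivAt_pow 2 x).const_mul β).div_const 2).neg).congr_deriv ?_
    norm_num
    ring
  have h2 : HasDerivAt (fun x : ℝ => β * x) β x := by
    simpa using (hasDerivAt_id x).const_mul β
  have h3 := h1.exp.mul h2.cosh
  have hc : Real.cosh (β * x) ≠ 0 := (Real.cosh_pos _).ne'
  refine h3.congr_deriv ?_
  rw [cwProfile, Real.tanh_eq_sinh_div_cosh]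
  field_simp
  ring

lemma continuous_cwProfile (β : ℝ) : Continuous (cwProfile β) := by
  unfold cwProfile; fun_prop

lemma continuous_tanh_mul_sub (β : ℝ) : Continuous fun x : ℝ => Real.tanh (β * x) - x := by
  simp only [Real.tanh_eq_sinh_div_cosh]
  have : ∀ x : ℝ, Real.cosh (β * x) ≠ 0 := fun x => (Real.cosh_pos _).ne'
  fun_prop (disch := assumption)

lemma tanh_mul_gt_eventually {β : ℝ} (hβ : 1 < β) :
    ∀ᶠ x in 𝓝[>] (0 : ℝ), 0 < Real.tanh (β * x) - x := by
  have h2 : HasDerivAt (fun x : ℝ => β * x) β 0 := by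
    simpa using (hasDerivAt_id (0 : ℝ)).const_mul β
  have h3 := (h2.sinh.div h2.cosh (by simp)).sub (hasDerivAt_id (0 : ℝ))
  have h4 : HasDerivAt (fun x : ℝ => Real.tanh (β * x) - x) (β - 1) 0 := by
    simp only [Real.tanh_eq_sinh_div_cosh]
    refine h3.congr_deriv ?_
    simp
  have h5 := (hasDerivWithinAt_iff_tendsto_slope' (by simp)).1
    (h4.hasDerivWithinAt (s := Set.Ioi 0))
  filter_upwards [h5.eventually (lt_mem_nhds (sub_pos.2 hβ)), self_mem_nhdsWithin] with x hx hx0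
  rw [slope_def_field] at hx
  simp only [mul_zero, Real.tanh_zero, sub_zero] at hx
  exact (div_pos_iff_of_pos_right hx0).1 hx

lemma tanh_mul_gt_of_lt {β m : ℝ} (hβ : 1 < β)
    (hm_unique : ∀ x : ℝ, 0 < x → Real.tanh (β * x) = x → x = m)
    {x : ℝ} (hx : 0 < x) (hxm : x < m) : 0 < Real.tanh (β * x) - x := by
  by_contra! hle
  obtain ⟨y, hy, hy0, hyx⟩ :=
    ((tanh_mul_gt_eventually hβ).and (Ioo_mem_nhdsGT hx)).exists
  obtain ⟨z, hz, hz0⟩ := intermediate_value_Icc' hyx.le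
    (continuous_tanh_mul_sub β).continuousOn ⟨hle, hy.le⟩
  have := hm_unique z (hy0.trans_le hz.1) (sub_eq_zero.1 hz0)
  linarith [hz.2]

lemma tanh_mul_lt_of_gt {β m : ℝ} (hm : 0 < m)
    (hm_unique : ∀ x : ℝ, 0 < x → Real.tanh (β * x) = x → x = m)
    {x : ℝ} (hxm : m < x) : Real.tanh (β * x) - x < 0 := by
  by_contra! hle
  have h1 : Real.tanh (β * (x + 1)) - (x + 1) ≤ 0 := by
    linarith [Real.tanh_lt_one (β * (x + 1))]
  obtain ⟨z, hz, hz0⟩ := intermediate_value_Icc' (by linarith : x ≤ x + 1)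
    (continuous_tanh_mul_sub β).continuousOn ⟨h1, hle⟩
  have := hm_unique z (by linarith [hz.1]) (sub_eq_zero.1 hz0)
  linarith [hz.1]

lemma cwProfile_lt {β m : ℝ} (hβ : 1 < β) (hm : 0 < m)
    (hm_unique : ∀ x : ℝ, 0 < x → Real.tanh (β * x) = x → x = m)
    {x : ℝ} (hx : |x| ≠ m) : cwProfile β x < cwProfile β m := by
  rw [← cwProfile_abs]
  have hpos : ∀ y, 0 < β * cwProfile β y := fun y => mul_pos (by linarith) (cwProfile_pos β y)
  rcases lt_or_gt_of_ne hx with h | h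
  · refine strictMonoOn_of_deriv_pos (convex_Icc 0 m) (continuous_cwProfile β).continuousOn ?_
      ⟨abs_nonneg x, h.le⟩ ⟨hm.le, le_rfl⟩ h
    intro y hy
    rw [interior_Icc] at hy
    rw [(hasDerivAt_cwProfile β y).deriv]
    exact mul_pos (hpos y) (tanh_mul_gt_of_lt hβ hm_unique hy.1 hy.2)
  · refine strictAntiOn_of_deriv_neg (convex_Ici m) (continuous_cwProfile β).continuousOn ?_
      (Set.mem_Ici.2 le_rfl) (Set.mem_Ici.2 h.le) h
    intro y hy
    rw [interior_Ici] at hy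
    rw [(hasDerivAt_cwProfile β y).deriv]
    exact mul_neg_of_pos_of_neg (hpos y) (tanh_mul_lt_of_gt hm hm_unique hy)

lemma exists_cwProfile_le {β m : ℝ} (hβ : 1 < β) (hm : 0 < m)
    (hm_unique : ∀ x : ℝ, 0 < x → Real.tanh (β * x) = x → x = m)
    {δ : ℝ} (hδ : 0 < δ) :
    ∃ q, 0 ≤ q ∧ q < cwProfile β m ∧
      ∀ x : ℝ, |x| ≤ 1 → δ ≤ |(|x| - m)| → cwProfile β x ≤ q := by
  let K : Set ℝ := Set.Icc (-1) 1 ∩ {x | δ ≤ |(|x| - m)|}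
  have hK : IsCompact K := isCompact_Icc.inter_right
    (isClosed_le continuous_const (by fun_prop))
  rcases K.eq_empty_or_nonempty with h | h
  · refine ⟨0, le_rfl, cwProfile_pos β m, fun x hx hd => ?_⟩
    have : x ∈ K := ⟨abs_le.1 hx, hd⟩
    simp [h] at this
  · obtain ⟨y, hy, hmax⟩ := hK.exists_isMaxOn h (continuous_cwProfile β).continuousOn
    refine ⟨cwProfile β y, (cwProfile_pos β y).le, cwProfile_lt hβ hm hm_unique ?_,
      fun x hx hd => hmax ⟨abs_le.1 hx, hd⟩⟩
    intro he
    have := hy.2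
    simp only [Set.mem_ofPred_eq, he, sub_self, abs_zero] at this
    linarith

lemma sum_exp_mul_spin (N : ℕ) (a : ℝ) :
    ∑ σ : Fin N → Bool, Real.exp (a * ∑ i, spin (σ i)) = (2 * Real.cosh a) ^ N := by
  have h := Finset.prod_univ_sum (fun _ : Fin N => (Finset.univ : Finset Bool))
    (fun _ b => Real.exp (a * spin b))
  rw [Fintype.piFinset_univ] at h
  simp only [Finset.mul_sum, Real.exp_sum]
  rw [← h]
  simp [spin, Real.cosh_eq]
  ring

lemma sum_exp_tangent (β : ℝ) (N : ℕ) (x : ℝ) :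
    ∑ σ : Fin N → Bool, Real.exp (β * x * (∑ i, spin (σ i)) - N * (β * x ^ 2 / 2)) =
      (2 * cwProfile β x) ^ N := by
  simp only [sub_eq_add_neg, Real.exp_add]
  rw [← Finset.sum_mul, sum_exp_mul_spin, ← mul_neg, Real.exp_nat_mul, ← mul_pow, cwProfile]
  ring

lemma cwWeight_pos (β : ℝ) (N : ℕ) (σ : Fin N → Bool) : 0 < cwWeight β N σ := Real.exp_pos _

lemma cwZ_pos (β : ℝ) (N : ℕ) : 0 < cwZ β N :=
  Finset.sum_pos (fun σ _ => cwWeight_pos β N σ) Finset.univ_nonempty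

lemma cwProfile_pow_le_cwZ {β : ℝ} (hβ : 0 ≤ β) {N : ℕ} (hN : 0 < N) (x : ℝ) :
    (2 * cwProfile β x) ^ N ≤ cwZ β N := by
  rw [← sum_exp_tangent]
  refine Finset.sum_le_sum fun σ _ => Real.exp_le_exp.2 ?_
  have hN' : (0 : ℝ) < N := by exact_mod_cast hN
  set S := ∑ i, spin (σ i)
  have : β / (2 * N) * S ^ 2 - (β * x * S - N * (β * x ^ 2 / 2)) =
      β / (2 * N) * (S - N * x) ^ 2 := by field_simp; ring
  have h2 : 0 ≤ β / (2 * N) * (S - N * x) ^ 2 := by positivity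
  linarith

lemma abs_spin (b : Bool) : |spin b| = 1 := by cases b <;> simp [spin]

lemma abs_mean_spin_le {N : ℕ} (σ : Fin N → Bool) : |(∑ i, spin (σ i)) / N| ≤ 1 := by
  rw [abs_div, Nat.abs_cast]
  refine div_le_one_of_le₀ ?_ (Nat.cast_nonneg _)
  refine (Finset.abs_sum_le_sum_abs _ _).trans ?_
  simp [abs_spin]

lemma card_image_mean_spin_le (N : ℕ) (s : Finset (Fin N → Bool)) :
    (s.image fun σ => (∑ i, spin (σ i)) / N).card ≤ N + 1 := by
  have : (s.image fun σ => (∑ i, spin (σ i)) / N) ⊆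
      (Finset.range (N + 1)).image fun k : ℕ => (2 * (k : ℝ) - N) / N := by
    intro y hy
    obtain ⟨σ, -, rfl⟩ := Finset.mem_image.1 hy
    refine Finset.mem_image.2 ⟨(Finset.univ.filter fun i => σ i = true).card, ?_, ?_⟩
    · rw [Finset.mem_range, Nat.lt_succ_iff]
      simpa using Finset.card_filter_le (Finset.univ : Finset (Fin N)) (fun i => σ i = true)
    · congr 1
      have : ∀ b : Bool, spin b = 2 * (if b = true then 1 else 0) - 1 := by
        intro b; cases b <;> norm_num [spin]
      simp only [this, Finset.sum_sub_distrib, ← Finset.mul_sum]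
      simp
  exact (Finset.card_le_card this).trans (Finset.card_image_le.trans (by simp))

lemma sum_cwWeight_le {β q : ℝ} (hq0 : 0 ≤ q) {N : ℕ} (hN : 0 < N) (s : Finset (Fin N → Bool))
    (hs : ∀ σ ∈ s, cwProfile β ((∑ i, spin (σ i)) / N) ≤ q) :
    ∑ σ ∈ s, cwWeight β N σ ≤ (N + 1) * (2 * q) ^ N := by
  classical
  have hN' : (N : ℝ) ≠ 0 := by exact_mod_cast hN.ne'
  let T : ℝ → (Fin N → Bool) → ℝ := fun x σ =>
    Real.exp (β * x * (∑ i, spin (σ i)) - N * (β * x ^ 2 / 2))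
  let V := s.image fun σ => (∑ i, spin (σ i)) / (N : ℝ)
  have hV : (V.card : ℝ) ≤ N + 1 := by exact_mod_cast card_image_mean_spin_le N s
  have hq : ∀ x ∈ V, ∑ σ, T x σ ≤ (2 * q) ^ N := by
    intro x hx
    obtain ⟨σ, hσ, rfl⟩ := Finset.mem_image.1 hx
    rw [sum_exp_tangent]
    have := cwProfile_pos β ((∑ i, spin (σ i)) / N)
    have := hs σ hσ
    gcongr
  calc ∑ σ ∈ s, cwWeight β N σ
      ≤ ∑ σ ∈ s, ∑ x ∈ V, T x σ := by
        refine Finset.sum_le_sum fun σ hσ => ?_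
        have : cwWeight β N σ = T ((∑ i, spin (σ i)) / N) σ := by
          simp only [cwWeight, T]
          congr 1
          field_simp
          ring
        rw [this]
        exact Finset.single_le_sum (f := fun x => T x σ) (fun x _ => (Real.exp_pos _).le)
          (Finset.mem_image_of_mem _ hσ)
    _ = ∑ x ∈ V, ∑ σ ∈ s, T x σ := Finset.sum_comm
    _ ≤ ∑ x ∈ V, (2 * q) ^ N := by
        refine Finset.sum_le_sum fun x hx => le_trans ?_ (hq x hx)
        exact Finset.sum_le_sum_of_subset_of_nonneg (Finset.subset_univ _)
          fun σ _ _ => (Real.exp_pos _).le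
    _ = V.card * (2 * q) ^ N := by simp
    _ ≤ (N + 1) * (2 * q) ^ N := by
        gcongr

lemma integral_cwLaw (β : ℝ) (N : ℕ) (g : (Fin N → Bool) → ℝ) (f : ℝ → ℝ) :
    ∫ x, f x ∂(cwLaw β N g) = ∑ σ, cwWeight β N σ / cwZ β N * f (g σ) := by
  rw [cwLaw, integral_finsetSum_measure]
  · refine Finset.sum_congr rfl fun σ _ => ?_
    rw [integral_smul_measure, integral_dirac,
      ENNReal.toReal_ofReal (div_pos (cwWeight_pos β N σ) (cwZ_pos β N)).le, smul_eq_mul]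
  · intro σ _
    exact (integrable_dirac (by simp)).smul_measure ENNReal.ofReal_ne_top

lemma spin_not (b : Bool) : spin (!b) = -spin b := by cases b <;> simp [spin]

lemma sum_cwWeight_neg (β : ℝ) (N : ℕ) (f : ℝ → ℝ) :
    ∑ σ, cwWeight β N σ / cwZ β N * f (-((∑ i, spin (σ i)) / N)) =
      ∑ σ, cwWeight β N σ / cwZ β N * f ((∑ i, spin (σ i)) / N) := by
  refine Fintype.sum_equiv (Equiv.piCongrRight fun _ : Fin N => Equiv.boolNot) _ _ fun σ => ?_
  simp [cwWeight, spin_not, neg_div]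

lemma sum_cwWeight_div (β : ℝ) (N : ℕ) : ∑ σ, cwWeight β N σ / cwZ β N = 1 := by
  rw [← Finset.sum_div]
  exact div_self (cwZ_pos β N).ne'

lemma tendsto_cw_deviation {β m : ℝ} (hβ : 1 < β) (hm : 0 < m)
    (hm_unique : ∀ x : ℝ, 0 < x → Real.tanh (β * x) = x → x = m) {δ : ℝ} (hδ : 0 < δ) :
    Tendsto (fun N : ℕ => ∑ σ : Fin N → Bool with δ ≤ |(|(∑ i, spin (σ i)) / N| - m)|,
      cwWeight β N σ / cwZ β N) atTop (𝓝 0) := by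
  obtain ⟨q, hq0, hqm, hq⟩ := exists_cwProfile_le hβ hm hm_unique hδ
  have hF := cwProfile_pos β m
  set r := q / cwProfile β m
  have hr0 : 0 ≤ r := by positivity
  have hr1 : r < 1 := (div_lt_one hF).2 hqm
  have hlim : Tendsto (fun N : ℕ => ((N : ℝ) + 1) * r ^ N) atTop (𝓝 0) := by
    have := (tendsto_self_mul_const_pow_of_lt_one hr0 hr1).add
      (tendsto_pow_atTop_nhds_zero_of_lt_one hr0 hr1)
    simpa [add_mul] using this
  refine tendsto_of_tendsto_of_tendsto_of_le_of_le' tendsto_const_nhds hlim ?_ ?_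
  · exact Eventually.of_forall fun N => Finset.sum_nonneg fun σ _ =>
      (div_pos (cwWeight_pos β N σ) (cwZ_pos β N)).le
  · filter_upwards [eventually_gt_atTop 0] with N hN
    rw [← Finset.sum_div]
    have h1 := sum_cwWeight_le (β := β) hq0 hN
      (Finset.univ.filter fun σ : Fin N → Bool => δ ≤ |(|(∑ i, spin (σ i)) / N| - m)|)
      (fun σ hσ => hq _ (abs_mean_spin_le σ) (Finset.mem_filter.1 hσ).2)
    have h2 := cwProfile_pow_le_cwZ (by linarith : 0 ≤ β) hN m
    calc _ ≤ ((N + 1) * (2 * q) ^ N) / (2 * cwProfile β m) ^ N := by gcongr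
      _ = (N + 1) * r ^ N := by
        simp only [r, mul_pow, div_pow]
        field_simp

/-- Law of large numbers for the Curie–Weiss model, supercritical case:
for `β > 1` the laws of `S_N / N` converge weakly to `(1/2)(δ_{-m(β)} + δ_{m(β)})`,
where `m(β) > 0` is the unique positive solution of `x = tanh (β x)`. -/
theorem cw_lln_supercritical (β : ℝ) (hβ : 1 < β) (m : ℝ) (hm : 0 < m)
    (hm_fix : Real.tanh (β * m) = m)
    (hm_unique : ∀ x : ℝ, 0 < x → Real.tanh (β * x) = x → x = m) :
    ∀ f : BoundedContinuousFunction ℝ ℝ,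
      Tendsto (fun N : ℕ =>
          ∫ x, f x ∂(cwLaw β N (fun σ => (∑ i, spin (σ i)) / N)))
        atTop (𝓝 (∫ x, f x
          ∂(((1 : ℝ≥0∞) / 2) • Measure.dirac (-m) + ((1 : ℝ≥0∞) / 2) • Measure.dirac m))) := by
  intro f
  let g : ℝ → ℝ := fun x => (f x + f (-x)) / 2
  have hg_abs : ∀ x, g |x| = g x := by
    intro x
    rcases abs_choice x with h | h <;> simp [g, h, add_comm]
  have hg_cont : Continuous g := by fun_prop
  have hg_bdd : ∀ x, |g x| ≤ ‖f‖ := by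
    intro x
    have h1 := abs_le.1 (f.norm_coe_le_norm x)
    have h2 := abs_le.1 (f.norm_coe_le_norm (-x))
    exact abs_le.2 ⟨by simp only [g]; linarith, by simp only [g]; linarith⟩
  have hlimit : ∫ x, f x
      ∂(((1 : ℝ≥0∞) / 2) • Measure.dirac (-m) + ((1 : ℝ≥0∞) / 2) • Measure.dirac m) = g m := by
    rw [integral_add_measure, integral_smul_measure, integral_smul_measure, integral_dirac,
      integral_dirac]
    · simp [g]; ring
    · exact (integrable_dirac (by simp)).smul_measure (by simp)
    · exact (integrable_dirac (by simp)).smul_measure (by simp)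
  have hmean : ∀ N : ℕ, ∫ x, f x ∂(cwLaw β N (fun σ => (∑ i, spin (σ i)) / N)) =
      ∑ σ, cwWeight β N σ / cwZ β N * g ((∑ i, spin (σ i)) / N) := by
    intro N
    have h := sum_cwWeight_neg β N f
    rw [integral_cwLaw]
    simp only [g, mul_div_assoc', mul_add, add_div, Finset.sum_add_distrib, ← Finset.sum_div, h]
    ring
  rw [hlimit]
  simp only [hmean]
  rw [Metric.tendsto_atTop']
  intro ε hε
  obtain ⟨δ, hδ, hgδ⟩ := Metric.continuousAt_iff.1 (hg_cont.continuousAt (x := m))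
    (ε / 2) (by linarith)
  have hdev := tendsto_cw_deviation hβ hm hm_unique hδ
  have hdev' := (hdev.const_mul (2 * ‖f‖)).eventually_lt_const (u := ε / 2)
    (by simpa using hε)
  obtain ⟨n, hn⟩ := eventually_atTop.1 hdev'
  refine ⟨n, fun N hN => ?_⟩
  specialize hn N hN.le
  have hp : ∀ σ, 0 ≤ cwWeight β N σ / cwZ β N := fun σ =>
    (div_pos (cwWeight_pos β N σ) (cwZ_pos β N)).le
  rw [Real.dist_eq]
  calc |∑ σ, cwWeight β N σ / cwZ β N * g ((∑ i, spin (σ i)) / N) - g m|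
      = |∑ σ, cwWeight β N σ / cwZ β N * (g ((∑ i, spin (σ i)) / N) - g m)| := by
        simp only [mul_sub, Finset.sum_sub_distrib]
        rw [← Finset.sum_mul, sum_cwWeight_div, one_mul]
    _ ≤ ∑ σ, |cwWeight β N σ / cwZ β N * (g ((∑ i, spin (σ i)) / N) - g m)| :=
        Finset.abs_sum_le_sum_abs _ _
    _ ≤ ∑ σ : Fin N → Bool, (cwWeight β N σ / cwZ β N * (ε / 2) +
          2 * ‖f‖ * (if δ ≤ |(|(∑ i, spin (σ i)) / N| - m)| then
            cwWeight β N σ / cwZ β N else 0)) := by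
        refine Finset.sum_le_sum fun σ _ => ?_
        rw [abs_mul, abs_of_nonneg (hp σ)]
        have hpσ := hp σ
        split_ifs with h
        · have h1 := abs_sub (g ((∑ i, spin (σ i)) / N)) (g m)
          have h2 := hg_bdd ((∑ i, spin (σ i)) / N)
          have h3 := hg_bdd m
          have h4 : |g ((∑ i, spin (σ i)) / N) - g m| ≤ 2 * ‖f‖ := by linarith
          nlinarith [mul_le_mul_of_nonneg_left h4 hpσ, mul_nonneg hpσ hε.le]
        · have h1 := hgδ (x := |(∑ i, spin (σ i)) / N|) (not_le.1 h)
          rw [hg_abs, Real.dist_eq] at h1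
          rw [mul_zero, add_zero]
          exact mul_le_mul_of_nonneg_left h1.le hpσ
    _ = ε / 2 + 2 * ‖f‖ * ∑ σ : Fin N → Bool with δ ≤ |(|(∑ i, spin (σ i)) / N| - m)|,
          cwWeight β N σ / cwZ β N := by
        rw [Finset.sum_add_distrib, ← Finset.sum_mul, sum_cwWeight_div, one_mul,
          ← Finset.mul_sum, Finset.sum_filter]
    _ < ε := by linarith
end

section
/- Asymptotics of subcritical Curie–Weiss correlations: fix 0 < β < 1 and an even ℓ ≥ 2. For each N ≥ ℓ let X_1,…,X_N be CW(β,N)-distributed. Then N^{ℓ/2} · E_{β,N}(X_1·X_2·…·X_ℓ) → (ℓ−1)!! · (β/(1−β))^{ℓ/2} as N → ∞, where (ℓ−1)!! = (ℓ−1)(ℓ−3)⋯3·1 is the double factorial. -/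
open MeasureTheory Filter Real Topology ENNReal

/-- The Gaussian linearization of a squared exponent (Hubbard–Stratonovich transform). -/
theorem integrable_exp_mul_sub_half_sq (c : ℝ) :
    Integrable (fun s : ℝ => exp (c * s - s ^ 2 / 2)) ∧
      ∫ s : ℝ, exp (c * s - s ^ 2 / 2) = √(2 * π) * exp (c ^ 2 / 2) := by
  have h : (fun s : ℝ => exp (c * s - s ^ 2 / 2)) =
      fun s => exp (-(1 / 2) * (s - c) ^ 2) * exp (c ^ 2 / 2) := by
    funext s
    rw [← Real.exp_add]
    ring_nf
  rw [h]
  refine ⟨((integrable_exp_neg_mul_sq (by norm_num : (0 : ℝ) < 1 / 2)).comp_sub_right c).mul_const _,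
    ?_⟩
  rw [integral_mul_const, integral_sub_right_eq_self (fun s : ℝ => exp (-(1 / 2) * s ^ 2)) c,
    integral_gaussian]
  congr 2
  ring

/-- The even moments of a centred Gaussian. -/
theorem integral_pow_two_mul_exp_neg_mul_sq {b : ℝ} (hb : 0 < b) (k : ℕ) :
    ∫ x : ℝ, x ^ (2 * k) * exp (-b * x ^ 2) =
      Nat.doubleFactorial (2 * k - 1) / (2 * b) ^ k * √(π / b) := by
  have habs : ∫ x : ℝ, x ^ (2 * k) * exp (-b * x ^ 2) =
      2 * ∫ x in Set.Ioi (0 : ℝ), x ^ ((2 * k : ℕ) : ℝ) * exp (-b * x ^ (2 : ℝ)) := by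
    simp only [Real.rpow_natCast, Real.rpow_two]
    rw [← integral_comp_abs (f := fun x : ℝ => x ^ (2 * k) * exp (-b * x ^ 2))]
    simp [pow_mul]
  have hexp : -(((2 * k : ℕ) : ℝ) + 1) / 2 = -(k : ℝ) + -(1 / 2) := by push_cast; ring
  have hexp' : (((2 * k : ℕ) : ℝ) + 1) / 2 = (k : ℝ) + 1 / 2 := by push_cast; ring
  rw [habs, integral_rpow_mul_exp_neg_mul_rpow two_pos
    (neg_one_lt_zero.trans_le (Nat.cast_nonneg _)) hb, hexp, hexp', Real.Gamma_nat_add_half,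
    rpow_add hb, rpow_neg hb.le, rpow_neg hb.le, Real.rpow_natCast, ← sqrt_eq_rpow,
    Real.sqrt_div pi_pos.le, mul_pow]
  field_simp

theorem Real.hasDerivAt_tanh (x : ℝ) : HasDerivAt tanh (1 / cosh x ^ 2) x := by
  have h := (hasDerivAt_sinh x).div (hasDerivAt_cosh x) (cosh_pos x).ne'
  have heq : tanh = sinh / cosh := by
    funext y
    simp [tanh_eq_sinh_div_cosh]
  rw [heq]
  rwa [← sq, ← sq, cosh_sq, add_sub_cancel_left, ← cosh_sq] at h

theorem Real.abs_tanh_le_abs (x : ℝ) : |tanh x| ≤ |x| := by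
  have h := (convex_univ (𝕜 := ℝ) (E := ℝ)).norm_image_sub_le_of_norm_hasDerivWithin_le (C := 1)
    (fun y _ => (hasDerivAt_tanh y).hasDerivWithinAt)
    (fun y _ => by
      rw [Real.norm_of_nonneg (by positivity)]
      exact div_le_one_of_le₀ (one_le_pow₀ (one_le_cosh y)) (by positivity))
    (Set.mem_univ 0) (Set.mem_univ x)
  simpa using h

theorem Real.one_add_half_sq_le_cosh (x : ℝ) : 1 + x ^ 2 / 2 ≤ cosh x := by
  have h : |x / 2| ≤ |sinh (x / 2)| := by
    rw [abs_sinh]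
    exact self_le_sinh_iff.2 (abs_nonneg _)
  have h' := sq_le_sq.2 h
  have hc : cosh x = cosh (x / 2) ^ 2 + sinh (x / 2) ^ 2 := by
    rw [← cosh_two_mul]
    ring_nf
  nlinarith [cosh_sq (x / 2)]

theorem tendsto_cosh_div_sqrt_pow (c : ℝ) :
    Tendsto (fun N : ℕ => cosh (c / √N) ^ N) atTop (𝓝 (exp (c ^ 2 / 2))) := by
  have hsq (N : ℕ) : (c / √(N : ℝ)) ^ 2 / 2 = c ^ 2 / 2 / N := by
    rw [div_pow, Real.sq_sqrt (Nat.cast_nonneg N)]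
    ring
  refine tendsto_of_tendsto_of_tendsto_of_le_of_le' (Real.tendsto_one_add_div_pow_exp (c ^ 2 / 2))
    tendsto_const_nhds (Eventually.of_forall fun N => ?_) ?_
  · rw [← hsq]
    exact pow_le_pow_left₀ (by positivity) (one_add_half_sq_le_cosh _) N
  · filter_upwards [eventually_ne_atTop 0] with N hN
    have hN' : (N : ℝ) ≠ 0 := Nat.cast_ne_zero.2 hN
    calc cosh (c / √N) ^ N ≤ exp ((c / √N) ^ 2 / 2) ^ N :=
          pow_le_pow_left₀ (cosh_pos _).le (cosh_le_exp_half_sq _) N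
      _ = exp (c ^ 2 / 2) := by
          rw [hsq, ← Real.exp_nat_mul]
          congr 1
          field_simp

theorem tendsto_sqrt_mul_tanh_div_sqrt (c : ℝ) :
    Tendsto (fun N : ℕ => √N * tanh (c / √N)) atTop (𝓝 c) := by
  have hd : HasDerivAt (fun h : ℝ => tanh (c * h)) c 0 := by
    have h := (hasDerivAt_tanh (c * 0)).comp (0 : ℝ) ((hasDerivAt_id (0 : ℝ)).const_mul c)
    simpa [Function.comp_def] using h
  have hinv : Tendsto (fun N : ℕ => (√(N : ℝ))⁻¹) atTop (𝓝[≠] 0) := by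
    refine tendsto_nhdsWithin_iff.2 ⟨?_, ?_⟩
    · exact tendsto_inv_atTop_zero.comp (tendsto_sqrt_atTop.comp tendsto_natCast_atTop_atTop)
    · filter_upwards [eventually_gt_atTop 0] with N hN
      have : (0 : ℝ) < N := Nat.cast_pos.2 hN
      exact inv_ne_zero (Real.sqrt_pos.2 this).ne'
  have h := (hasDerivAt_iff_tendsto_slope_zero.1 hd).comp hinv
  simpa [Function.comp_def, div_eq_mul_inv] using h

/-- The integrand obtained by summing the linearized Curie–Weiss weight over all configurations. -/
noncomputable def cwIntegrand (β : ℝ) (N ℓ : ℕ) (s : ℝ) : ℝ :=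
  cosh (√β * s / √N) ^ N * tanh (√β * s / √N) ^ ℓ * exp (-(1 / 2) * s ^ 2)

theorem sum_exp_mul_prod_spin (t : ℝ) {N ℓ : ℕ} (h : ℓ ≤ N) :
    ∑ σ : Fin N → Bool, exp (t * ∑ i, spin (σ i)) *
      ∏ j ∈ Finset.univ.filter (fun j : Fin N => (j : ℕ) < ℓ), spin (σ j) =
      2 ^ N * (cosh t ^ N * tanh t ^ ℓ) := by
  have hsite (i : Fin N) : ∑ b : Bool, exp (t * spin b) * (if (i : ℕ) < ℓ then spin b else 1) =
      2 * cosh t * (if (i : ℕ) < ℓ then tanh t else 1) := by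
    have hc := (cosh_pos t).ne'
    split_ifs
    · rw [mul_assoc, tanh_eq_sinh_div_cosh, mul_div_cancel₀ _ hc, sinh_eq]
      simp [spin]
      ring
    · simp [spin, cosh_eq]
      ring
  calc _ = ∑ σ : Fin N → Bool,
        ∏ i, exp (t * spin (σ i)) * (if (i : ℕ) < ℓ then spin (σ i) else 1) := by
        refine Finset.sum_congr rfl fun σ _ => ?_
        rw [Finset.mul_sum, Real.exp_sum, Finset.prod_filter, Finset.prod_mul_distrib]
    _ = ∏ i : Fin N, ∑ b : Bool, exp (t * spin b) * (if (i : ℕ) < ℓ then spin b else 1) := by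
        rw [Finset.prod_univ_sum, Fintype.piFinset_univ]
    _ = _ := by
        simp_rw [hsite]
        rw [Finset.prod_mul_distrib, ← Finset.prod_filter, Finset.prod_const, Finset.prod_const,
          Fin.card_filter_val_lt, Finset.card_univ, Fintype.card_fin, min_eq_right h]
        ring

theorem sum_cwWeight_mul_prod_spin {β : ℝ} (hβ : 0 ≤ β) {N ℓ : ℕ} (h : ℓ ≤ N) :
    √(2 * π) * ∑ σ : Fin N → Bool, cwWeight β N σ *
      ∏ j ∈ Finset.univ.filter (fun j : Fin N => (j : ℕ) < ℓ), spin (σ j) =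
      2 ^ N * ∫ s : ℝ, cwIntegrand β N ℓ s := by
  have hweight (σ : Fin N → Bool) : √(2 * π) * cwWeight β N σ =
      ∫ s : ℝ, exp ((√β / √N * ∑ i, spin (σ i)) * s - s ^ 2 / 2) := by
    rw [(integrable_exp_mul_sub_half_sq _).2, cwWeight, mul_pow, div_pow, Real.sq_sqrt hβ,
      Real.sq_sqrt (Nat.cast_nonneg N)]
    congr 2
    ring
  rw [Finset.mul_sum, ← integral_const_mul]
  simp_rw [← mul_assoc, hweight, ← integral_mul_const]
  rw [← integral_finsetSum _ fun σ _ => (integrable_exp_mul_sub_half_sq _).1.mul_const _]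
  congr 1
  funext s
  rw [cwIntegrand, ← mul_assoc, ← sum_exp_mul_prod_spin _ h, Finset.sum_mul]
  refine Finset.sum_congr rfl fun σ _ => ?_
  rw [mul_right_comm _ _ (exp _), ← Real.exp_add]
  congr 2
  ring

theorem tendsto_integral_cwIntegrand {β : ℝ} (hβ0 : 0 < β) (hβ1 : β < 1) (ℓ : ℕ) :
    Tendsto (fun N : ℕ => √N ^ ℓ * ∫ s : ℝ, cwIntegrand β N ℓ s) atTop
      (𝓝 (√β ^ ℓ * ∫ s : ℝ, s ^ ℓ * exp (-((1 - β) / 2) * s ^ 2))) := by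
  have hgauss (s : ℝ) : exp ((√β * s) ^ 2 / 2) * exp (-(1 / 2) * s ^ 2) =
      exp (-((1 - β) / 2) * s ^ 2) := by
    rw [← Real.exp_add, mul_pow, Real.sq_sqrt hβ0.le]
    ring_nf
  have hint : Integrable fun s : ℝ => s ^ ℓ * exp (-((1 - β) / 2) * s ^ 2) := by
    simpa using integrable_rpow_mul_exp_neg_mul_sq (b := (1 - β) / 2) (by linarith)
      (neg_one_lt_zero.trans_le (Nat.cast_nonneg (α := ℝ) ℓ))
  simp_rw [← integral_const_mul]
  refine tendsto_integral_filter_of_dominated_convergence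
    (fun s => √β ^ ℓ * ‖s ^ ℓ * exp (-((1 - β) / 2) * s ^ 2)‖) ?_ ?_
    (hint.norm.const_mul _) ?_
  · refine Eventually.of_forall fun N => Measurable.aestronglyMeasurable ?_
    have htanh : Measurable tanh := by
      have : tanh = fun x : ℝ => sinh x / cosh x := funext tanh_eq_sinh_div_cosh
      rw [this]
      fun_prop
    unfold cwIntegrand
    fun_prop
  · filter_upwards [eventually_gt_atTop 0] with N hN
    refine Eventually.of_forall fun s => ?_
    have hN' : (0 : ℝ) < √N := Real.sqrt_pos.2 (Nat.cast_pos.2 hN)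
    have hN0 : (N : ℝ) ≠ 0 := Nat.cast_ne_zero.2 hN.ne'
    have htanh : √N * |tanh (√β * s / √N)| ≤ √β * |s| := by
      calc √N * |tanh (√β * s / √N)| ≤ √N * |√β * s / √N| := by
            exact mul_le_mul_of_nonneg_left (abs_tanh_le_abs _) hN'.le
        _ = √β * |s| := by
            rw [abs_div, abs_mul, abs_of_pos hN', abs_of_nonneg (Real.sqrt_nonneg β)]
            field_simp
    have hcosh : cosh (√β * s / √N) ^ N ≤ exp ((√β * s) ^ 2 / 2) := by
      calc cosh (√β * s / √N) ^ N ≤ exp ((√β * s / √N) ^ 2 / 2) ^ N :=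
            pow_le_pow_left₀ (cosh_pos _).le (cosh_le_exp_half_sq _) N
        _ = exp ((√β * s) ^ 2 / 2) := by
            rw [← Real.exp_nat_mul, div_pow, Real.sq_sqrt (Nat.cast_nonneg N)]
            congr 1
            field_simp
    calc ‖√N ^ ℓ * cwIntegrand β N ℓ s‖
        = (√N * |tanh (√β * s / √N)|) ^ ℓ *
            (cosh (√β * s / √N) ^ N * exp (-(1 / 2) * s ^ 2)) := by
          simp only [cwIntegrand, norm_mul, norm_pow, Real.norm_eq_abs, abs_of_pos hN',
            abs_of_pos (cosh_pos _), Real.abs_exp]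
          ring
      _ ≤ (√β * |s|) ^ ℓ * (exp ((√β * s) ^ 2 / 2) * exp (-(1 / 2) * s ^ 2)) := by
          have := cosh_pos (√β * s / √N)
          gcongr
      _ = √β ^ ℓ * ‖s ^ ℓ * exp (-((1 - β) / 2) * s ^ 2)‖ := by
          rw [hgauss, norm_mul, norm_pow, Real.norm_eq_abs, Real.norm_eq_abs, Real.abs_exp]
          ring
  · refine Eventually.of_forall fun s => ?_
    have h := ((tendsto_sqrt_mul_tanh_div_sqrt (√β * s)).pow ℓ).mul
      ((tendsto_cosh_div_sqrt_pow (√β * s)).mul_const (exp (-(1 / 2) * s ^ 2)))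
    rw [hgauss] at h
    convert h using 2
    · rw [cwIntegrand]
      ring
    · ring

theorem cwCorr_eq_integral_div {β : ℝ} (hβ : 0 ≤ β) {N ℓ : ℕ} (h : ℓ ≤ N) :
    cwCorr β N ℓ = (∫ s : ℝ, cwIntegrand β N ℓ s) / ∫ s : ℝ, cwIntegrand β N 0 s := by
  have hZ : √(2 * π) * cwZ β N = 2 ^ N * ∫ s : ℝ, cwIntegrand β N 0 s := by
    simpa [cwZ] using sum_cwWeight_mul_prod_spin hβ (Nat.zero_le N)
  have hπ : √(2 * π) ≠ 0 := (Real.sqrt_pos.2 (by positivity)).ne'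
  rw [cwCorr, cwExp, ← mul_div_mul_left _ _ hπ, sum_cwWeight_mul_prod_spin hβ h, hZ,
    mul_div_mul_left _ _ (by positivity)]

/-- Asymptotics of subcritical Curie–Weiss correlations: for `0 < β < 1` and even `ℓ ≥ 2`,
`N^{ℓ/2} · E_{β,N}(X_1 ⋯ X_ℓ) → (ℓ−1)!! (β/(1−β))^{ℓ/2}` as `N → ∞`. -/
theorem cw_corr_subcritical (β : ℝ) (hβ0 : 0 < β) (hβ1 : β < 1)
    (ℓ : ℕ) (hℓ : Even ℓ) (hℓ2 : 2 ≤ ℓ) :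
    Tendsto (fun N : ℕ => (N : ℝ) ^ ((ℓ : ℝ) / 2) * cwCorr β N ℓ)
      atTop (𝓝 ((Nat.doubleFactorial (ℓ - 1) : ℝ) * (β / (1 - β)) ^ (ℓ / 2))) := by
  obtain ⟨k, rfl⟩ := hℓ.two_dvd
  have hb : 0 < (1 - β) / 2 := by linarith
  have hnum := tendsto_integral_cwIntegrand hβ0 hβ1 (2 * k)
  have hden := tendsto_integral_cwIntegrand hβ0 hβ1 0
  have hmass : √(π / ((1 - β) / 2)) ≠ 0 := (Real.sqrt_pos.2 (by positivity)).ne'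
  simp only [pow_zero, one_mul, integral_gaussian] at hden
  rw [integral_pow_two_mul_exp_neg_mul_sq hb, mul_div_cancel₀ _ two_ne_zero] at hnum
  have h := hnum.div hden hmass
  have hlim : √β ^ (2 * k) * ((Nat.doubleFactorial (2 * k - 1) : ℝ) / (1 - β) ^ k *
      √(π / ((1 - β) / 2))) / √(π / ((1 - β) / 2)) =
      (Nat.doubleFactorial (2 * k - 1) : ℝ) * (β / (1 - β)) ^ (2 * k / 2) := by
    rw [← mul_assoc, mul_div_cancel_right₀ _ hmass, Nat.mul_div_cancel_left _ two_pos, pow_mul,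
      Real.sq_sqrt hβ0.le, div_pow]
    ring
  rw [hlim] at h
  refine h.congr' ?_
  filter_upwards [eventually_ge_atTop (2 * k)] with N hN
  have hpow : (N : ℝ) ^ (((2 * k : ℕ) : ℝ) / 2) = √N ^ (2 * k) := by
    rw [pow_mul, Real.sq_sqrt (Nat.cast_nonneg N), Nat.cast_mul, Nat.cast_two,
      mul_div_cancel_left₀ _ two_ne_zero, Real.rpow_natCast]
  rw [Pi.div_apply, hpow, cwCorr_eq_integral_div hβ0.le hN, mul_div_assoc]
end
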